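/- Gagliardo–Nirenberg type inequality for the difference between a continuous function and a piecewise constant function (Lemma 4.1). There exists a constant C₅ > 0 (one may take C₅ = 1152), independent of n, with the following property: for every integer n ≥ 2 with Δx = 1/n, every w absolutely continuous on [0,1] with ∂_x w ∈ L²(0,1), and every piecewise constant function s(x) = Σ_{i=1}^n z_i 1_{V_i}(x) with z₁,…,z_n ∈ ℝ, one has ∫_{Δx}^1 |s(x) − w(x)|⁴ dx ≤ C₅ ‖s − w‖⁴_{L²(Δx,1)} + C₅ ( ‖δ_x s − ∂_x w‖²_{L²(Δx,1)} + ‖∂_x w − ∂_x w(· − Δx)‖²_{L²(Δx,1)} + Δx ‖∂_x w‖²_{L²(0,1)} ) ‖s − w‖²_{L²(Δx,1)}, where δ_x s(x) = (s(x) − s(x−Δx))/Δx and ‖f‖_{L²(Δx,1)} = (∫_{Δx}^1 |f|² dx)^{1/2}. -/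

import Mathlib

open MeasureTheory

/-- Cauchy–Schwarz inequality against the constant function `1`. -/
theorem sq_intervalIntegral_le {f : ℝ → ℝ} {a b : ℝ} (hab : a ≤ b)
    (hf : IntervalIntegrable f volume a b)
    (hf2 : IntervalIntegrable (fun x => f x ^ 2) volume a b) :
    (∫ x in a..b, f x) ^ 2 ≤ (b - a) * ∫ x in a..b, f x ^ 2 := by
  rcases hab.eq_or_lt with rfl | hlt
  · simp
  have hpos : 0 < b - a := sub_pos.2 hlt
  set I := ∫ x in a..b, f x
  have key : 0 ≤ ∫ x in a..b, ((b - a) * f x - I) ^ 2 :=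
    intervalIntegral.integral_nonneg hab fun x _ => sq_nonneg _
  have hexp : (∫ x in a..b, ((b - a) * f x - I) ^ 2)
      = (b - a) ^ 2 * (∫ x in a..b, f x ^ 2) - 2 * (b - a) * I * I + (b - a) * I ^ 2 := by
    have h1 : (fun x => ((b - a) * f x - I) ^ 2)
        = fun x => ((b - a) ^ 2 * f x ^ 2 - 2 * (b - a) * I * f x) + I ^ 2 := by
      funext x; ring
    rw [h1, intervalIntegral.integral_add ((hf2.const_mul _).sub (hf.const_mul _))
      intervalIntegrable_const, intervalIntegral.integral_sub (hf2.const_mul _) (hf.const_mul _),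
      intervalIntegral.integral_const_mul, intervalIntegral.integral_const_mul,
      intervalIntegral.integral_const, smul_eq_mul]
  rw [hexp] at key
  have : 0 ≤ (b - a) * ((b - a) * (∫ x in a..b, f x ^ 2) - I ^ 2) := by linarith
  linarith [nonneg_of_mul_nonneg_right this hpos]

theorem memLp_comp_floor_div {h : ℝ} (hh : 0 < h) (q : ℕ → ℝ) (a b : ℝ) :
    MemLp (fun x => q ⌊x / h⌋₊) 2 (volume.restrict (Set.Ioc a b)) := by
  refine MemLp.of_bound (C := ∑ i ∈ Finset.range (⌊b / h⌋₊ + 1), |q i|) ?_ ?_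
  · exact ((measurable_from_nat (f := q)).comp
      (Nat.measurable_floor.comp (measurable_id.div_const h))).aestronglyMeasurable
  · filter_upwards [ae_restrict_mem measurableSet_Ioc] with x hx
    rw [Real.norm_eq_abs]
    refine Finset.single_le_sum (f := fun i => |q i|) (fun i _ => abs_nonneg _) ?_
    rw [Finset.mem_range, Nat.lt_succ_iff]
    exact Nat.floor_le_floor (div_le_div_of_nonneg_right hx.2 hh.le)

theorem floor_div_eq {h x : ℝ} (hh : 0 < h) {k : ℕ} (h1 : k * h ≤ x) (h2 : x < (k + 1) * h) :
    ⌊x / h⌋₊ = k := by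
  have hx : 0 ≤ x := le_trans (by positivity) h1
  rw [Nat.floor_eq_iff (by positivity)]
  exact ⟨(le_div_iff₀ hh).2 h1, (div_lt_iff₀ hh).2 h2⟩

theorem integral_comp_floor_div {h : ℝ} (hh : 0 < h) (q : ℕ → ℝ) (k : ℕ) :
    ∫ x in (k * h)..((k + 1) * h), q ⌊x / h⌋₊ = h * q k := by
  have hle : (k : ℝ) * h ≤ (k + 1) * h := by nlinarith
  have : ∫ x in (k * h)..((k + 1) * h), q ⌊x / h⌋₊ = ∫ _x in (k * h)..((k + 1) * h), q k := by
    rw [intervalIntegral.integral_of_le hle, intervalIntegral.integral_of_le hle,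
      integral_Ioc_eq_integral_Ioo, integral_Ioc_eq_integral_Ioo]
    refine setIntegral_congr_fun measurableSet_Ioo fun x hx => ?_
    simp only [floor_div_eq hh hx.1.le hx.2]
  rw [this, intervalIntegral.integral_const, smul_eq_mul]
  ring

theorem intervalIntegrable_of_memLp_two {f : ℝ → ℝ} {a b : ℝ} (hab : a ≤ b)
    (hf : MemLp f 2 (volume.restrict (Set.Ioc a b))) : IntervalIntegrable f volume a b :=
  (intervalIntegrable_iff_integrableOn_Ioc_of_le hab).2 (hf.integrable (by norm_num))

theorem intervalIntegrable_sq_of_memLp_two {f : ℝ → ℝ} {a b : ℝ} (hab : a ≤ b)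
    (hf : MemLp f 2 (volume.restrict (Set.Ioc a b))) :
    IntervalIntegrable (fun x => f x ^ 2) volume a b :=
  (intervalIntegrable_iff_integrableOn_Ioc_of_le hab).2 hf.integrable_sq

theorem sq_intervalIntegral_subinterval_le {f : ℝ → ℝ} {a b c d : ℝ} (hac : a ≤ c) (hcd : c ≤ d)
    (hdb : d ≤ b) (hf : MemLp f 2 (volume.restrict (Set.Ioc a b))) :
    (∫ x in c..d, f x) ^ 2 ≤ (d - c) * ∫ x in a..b, f x ^ 2 := by
  have hf' : MemLp f 2 (volume.restrict (Set.Ioc c d)) :=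
    hf.mono_measure (Measure.restrict_mono (Set.Ioc_subset_Ioc hac hdb) le_rfl)
  refine (sq_intervalIntegral_le hcd (intervalIntegrable_of_memLp_two hcd hf')
    (intervalIntegrable_sq_of_memLp_two hcd hf')).trans ?_
  refine mul_le_mul_of_nonneg_left ?_ (sub_nonneg.2 hcd)
  exact intervalIntegral.integral_mono_interval hac hcd hdb
    (Filter.Eventually.of_forall fun x => sq_nonneg _)
    (intervalIntegrable_sq_of_memLp_two (hac.trans (hcd.trans hdb)) hf)

/-- The difference between a step function and an absolutely continuous function stays close to
a constant as soon as the jumps are close to the increments of the latter. -/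
theorem exists_sq_step_sub_le {n : ℕ} {h : ℝ} (hh : 0 < h) (hn : n * h = 1) {w w' : ℝ → ℝ}
    (hw' : MemLp w' 2 (volume.restrict (Set.Ioc 0 1)))
    (hw : ∀ x ∈ Set.Icc (0 : ℝ) 1, w x = w 0 + ∫ y in (0 : ℝ)..x, w' y) (z : ℕ → ℝ) :
    ∃ e : ℝ, ∀ x ∈ Set.Ico h 1, (z (⌊x / h⌋₊ + 1) - w x - e) ^ 2 ≤
      2 * ((∫ x in h..1, ((z (⌊x / h⌋₊ + 1) - z ⌊x / h⌋₊) / h - w' x) ^ 2)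
        + h * ∫ x in (0 : ℝ)..1, w' x ^ 2) := by
  set q : ℕ → ℝ := fun i => (z (i + 1) - z i) / h with hq
  set g : ℝ → ℝ := fun x => q ⌊x / h⌋₊ - w' x
  have hwi : ∀ a b : ℝ, 0 ≤ a → a ≤ b → b ≤ 1 → IntervalIntegrable w' volume a b := by
    intro a b ha hab hb
    exact intervalIntegrable_of_memLp_two hab
      (hw'.mono_measure (Measure.restrict_mono (Set.Ioc_subset_Ioc ha hb) le_rfl))
  have hwsub : ∀ a b : ℝ, 0 ≤ a → a ≤ b → b ≤ 1 → ∫ y in a..b, w' y = w b - w a := by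
    intro a b ha hab hb
    rw [hw a ⟨ha, hab.trans hb⟩, hw b ⟨ha.trans hab, hb⟩,
      ← intervalIntegral.integral_add_adjacent_intervals (hwi 0 a le_rfl ha (hab.trans hb))
        (hwi a b ha hab hb)]
    ring
  have hgL : MemLp g 2 (volume.restrict (Set.Ioc h 1)) :=
    (memLp_comp_floor_div hh q h 1).sub
      (hw'.mono_measure (Measure.restrict_mono (Set.Ioc_subset_Ioc hh.le le_rfl) le_rfl))
  have hgi : ∀ a b : ℝ, h ≤ a → a ≤ b → b ≤ 1 → IntervalIntegrable g volume a b := by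
    intro a b ha hab hb
    exact intervalIntegrable_of_memLp_two hab
      (hgL.mono_measure (Measure.restrict_mono (Set.Ioc_subset_Ioc ha hb) le_rfl))
  have htel : ∀ k : ℕ, k + 1 ≤ n →
      (z (k + 1) - w ((k + 1) * h)) - (z 1 - w h) = ∫ x in h..((k + 1) * h), g x := by
    intro k
    induction k with
    | zero => intro _; simp
    | succ k ih =>
      intro hk
      have hk' : ((k : ℝ) + 1 + 1) * h ≤ 1 :=
        (mul_le_mul_of_nonneg_right (by exact_mod_cast hk) hh.le).trans_eq hn
      have h1 : h ≤ ((k : ℝ) + 1) * h := by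
        nlinarith [mul_nonneg (Nat.cast_nonneg' k : (0 : ℝ) ≤ k) hh.le]
      have h2 : ((k : ℝ) + 1) * h ≤ ((k : ℝ) + 1 + 1) * h := by nlinarith
      have hc := integral_comp_floor_div hh q (k + 1)
      push_cast at hc ⊢
      rw [← intervalIntegral.integral_add_adjacent_intervals (hgi _ _ le_rfl h1 (h2.trans hk'))
        (hgi _ _ h1 h2 hk'), ← ih (by omega)]
      have hsplit : ∫ x in ((k : ℝ) + 1) * h..((k : ℝ) + 1 + 1) * h, g x
          = h * q (k + 1) - (w (((k : ℝ) + 1 + 1) * h) - w (((k : ℝ) + 1) * h)) := by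
        rw [← hc, ← hwsub _ _ (hh.le.trans h1) h2 hk']
        refine intervalIntegral.integral_sub ?_ (hwi _ _ (hh.le.trans h1) h2 hk')
        exact intervalIntegrable_of_memLp_two h2 (memLp_comp_floor_div hh q _ _)
      rw [hsplit, hq]
      field_simp
      ring
  refine ⟨z 1 - w h, fun x hx => ?_⟩
  set k := ⌊x / h⌋₊
  have hx0 : 0 ≤ x := hh.le.trans hx.1
  have hkx : (k : ℝ) * h ≤ x := (le_div_iff₀ hh).1 (Nat.floor_le (by positivity))
  have hxk : x < (k + 1) * h := (div_lt_iff₀ hh).1 (Nat.lt_floor_add_one _)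
  have hkn : k + 1 ≤ n := by
    have : (k : ℝ) * h < n * h := by rw [hn]; exact hkx.trans_lt hx.2
    exact_mod_cast lt_of_mul_lt_mul_right this hh.le
  have hk1 : ((k : ℝ) + 1) * h ≤ 1 :=
    (mul_le_mul_of_nonneg_right (by exact_mod_cast hkn) hh.le).trans_eq hn
  have hA : (∫ x in h..((k + 1) * h), g x) ^ 2 ≤ ∫ x in h..1, g x ^ 2 := by
    have h0 : 0 ≤ ∫ x in h..1, g x ^ 2 :=
      intervalIntegral.integral_nonneg (hx.1.trans hx.2.le) fun _ _ => sq_nonneg _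
    have h1 := sq_intervalIntegral_subinterval_le le_rfl (hx.1.trans hxk.le) hk1 hgL
    nlinarith
  have hB : (∫ y in x..((k + 1) * h), w' y) ^ 2 ≤ h * ∫ x in (0 : ℝ)..1, w' x ^ 2 := by
    have h0 : 0 ≤ ∫ x in (0 : ℝ)..1, w' x ^ 2 :=
      intervalIntegral.integral_nonneg zero_le_one fun _ _ => sq_nonneg _
    have h1 := sq_intervalIntegral_subinterval_le hx0 hxk.le hk1 hw'
    nlinarith
  have hsum : z (k + 1) - w x - (z 1 - w h)
      = (∫ x in h..((k + 1) * h), g x) + ∫ y in x..((k + 1) * h), w' y := by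
    rw [← htel k hkn, hwsub x _ hx0 hxk.le hk1]
    ring
  rw [hsum]
  nlinarith [sq_nonneg ((∫ x in h..((k + 1) * h), g x) - ∫ y in x..((k + 1) * h), w' y)]

/-- A function on an interval of length at least `1 / 2` which is close to a constant has its
fourth power controlled by its square. -/
theorem integral_pow_four_le {u : ℝ → ℝ} {h e G : ℝ} (hh : h ≤ 1 / 2)
    (hu : MemLp u 2 (volume.restrict (Set.Ioc h 1)))
    (hG : ∀ x ∈ Set.Ico h 1, (u x - e) ^ 2 ≤ 2 * G) :
    ∫ x in h..1, u x ^ 4 ≤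
      16 * (∫ x in h..1, u x ^ 2) ^ 2 + 16 * G * ∫ x in h..1, u x ^ 2 := by
  have h1 : h ≤ 1 := by linarith
  have hui := intervalIntegrable_sq_of_memLp_two h1 hu
  set Q := ∫ x in h..1, u x ^ 2
  have hQ0 : 0 ≤ Q := intervalIntegral.integral_nonneg h1 fun _ _ => sq_nonneg _
  have hsup : ∀ x ∈ Set.Ico h 1, u x ^ 2 ≤ 4 * Q + 16 * G := by
    intro x hx
    have hmono : ∫ _y in h..1, u x ^ 2 ≤ ∫ y in h..1, (2 * u y ^ 2 + 16 * G) := by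
      refine intervalIntegral.integral_mono_on_of_le_Ioo h1 intervalIntegrable_const
        ((hui.const_mul 2).add intervalIntegrable_const) fun y hy => ?_
      have hx' := hG x hx
      have hy' := hG y ⟨hy.1.le, hy.2⟩
      nlinarith [sq_nonneg (u x - e + (u y - e)), sq_nonneg (u x - 2 * u y)]
    rw [intervalIntegral.integral_add (hui.const_mul 2) intervalIntegrable_const,
      intervalIntegral.integral_const_mul, intervalIntegral.integral_const,
      intervalIntegral.integral_const, smul_eq_mul, smul_eq_mul] at hmono
    nlinarith
  calc ∫ x in h..1, u x ^ 4 ≤ ∫ x in h..1, (4 * Q + 16 * G) * u x ^ 2 := by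
        rw [intervalIntegral.integral_of_le h1, intervalIntegral.integral_of_le h1,
          integral_Ioc_eq_integral_Ioo, integral_Ioc_eq_integral_Ioo]
        refine integral_mono_of_nonneg (Filter.Eventually.of_forall fun x => by positivity)
          ((hu.integrable_sq.const_mul _).mono_measure
            (Measure.restrict_mono Set.Ioo_subset_Ioc_self le_rfl)) ?_
        filter_upwards [ae_restrict_mem measurableSet_Ioo] with x hx
        have := mul_le_mul_of_nonneg_right (hsup x ⟨hx.1.le, hx.2⟩) (sq_nonneg (u x))
        calc u x ^ 4 = u x ^ 2 * u x ^ 2 := by ring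
          _ ≤ _ := this
    _ = (4 * Q + 16 * G) * Q := intervalIntegral.integral_const_mul _ _
    _ ≤ _ := by nlinarith

theorem intervalIntegral_congr_Ico {f g : ℝ → ℝ} {a b : ℝ} (hab : a ≤ b)
    (hfg : ∀ x ∈ Set.Ico a b, f x = g x) : ∫ x in a..b, f x = ∫ x in a..b, g x := by
  rw [intervalIntegral.integral_of_le hab, intervalIntegral.integral_of_le hab,
    integral_Ioc_eq_integral_Ioo, integral_Ioc_eq_integral_Ioo]
  exact setIntegral_congr_fun measurableSet_Ioo fun x hx => hfg x ⟨hx.1.le, hx.2⟩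

/-- **Gagliardo–Nirenberg type inequality for the difference between a continuous
function and a piecewise constant function (Lemma 4.1).**
There is a constant `C₅ > 0`, independent of `n`, such that for every `n ≥ 2` with
`Δx = 1/n`, every `w` absolutely continuous on `[0,1]` with `∂ₓw = w' ∈ L²(0,1)`, and
every piecewise constant `s = ∑_{i=1}^n z_i 1_{V_i}`,
`∫_{Δx}^1 |s − w|⁴ ≤ C₅ ‖s − w‖⁴_{L²(Δx,1)} + C₅ (‖δₓs − ∂ₓw‖²_{L²(Δx,1)}
  + ‖∂ₓw − ∂ₓw(·−Δx)‖²_{L²(Δx,1)} + Δx ‖∂ₓw‖²_{L²(0,1)}) ‖s − w‖²_{L²(Δx,1)}`. -/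
theorem stmt_7 :
    ∃ C₅ : ℝ, 0 < C₅ ∧
      ∀ n : ℕ, 2 ≤ n → ∀ Δx : ℝ, Δx = 1 / (n:ℝ) →
      ∀ w w' : ℝ → ℝ,
        IntervalIntegrable w' volume 0 1 →
        (∀ x ∈ Set.Icc (0:ℝ) 1, w x = w 0 + ∫ y in (0:ℝ)..x, w' y) →
        IntervalIntegrable (fun x => (w' x)^2) volume 0 1 →
      ∀ z : ℕ → ℝ, ∀ s : ℝ → ℝ,
        (∀ i ∈ Finset.Icc 1 n, ∀ x ∈
            (if i = n then Set.Icc (((i:ℝ) - 1) * Δx) ((i:ℝ) * Δx)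
             else Set.Ico (((i:ℝ) - 1) * Δx) ((i:ℝ) * Δx)), s x = z i) →
        (∫ x in Δx..1, (s x - w x)^4)
          ≤ C₅ * (∫ x in Δx..1, (s x - w x)^2)^2
            + C₅ * ((∫ x in Δx..1, ((s x - s (x - Δx)) / Δx - w' x)^2)
                + (∫ x in Δx..1, (w' x - w' (x - Δx))^2)
                + Δx * ∫ x in (0:ℝ)..1, (w' x)^2)
              * (∫ x in Δx..1, (s x - w x)^2) := by
  refine ⟨16, by norm_num, ?_⟩
  intro n hn h hh w w' hw'i hw hw'2 z s hs
  have hn0 : (0 : ℝ) < n := by exact_mod_cast (by omega : 0 < n)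
  have hpos : 0 < h := by rw [hh]; positivity
  have hnh : n * h = 1 := by rw [hh]; field_simp
  have hhalf : h ≤ 1 / 2 := by
    have : (2 : ℝ) ≤ n := by exact_mod_cast hn
    nlinarith
  have h1 : h ≤ 1 := by linarith
  have hstep : ∀ x ∈ Set.Ico (0 : ℝ) 1, s x = z (⌊x / h⌋₊ + 1) := by
    intro x hx
    have hx0 := hx.1
    have hkx : (⌊x / h⌋₊ : ℝ) * h ≤ x := (le_div_iff₀ hpos).1 (Nat.floor_le (by positivity))
    have hxk : x < (⌊x / h⌋₊ + 1) * h := (div_lt_iff₀ hpos).1 (Nat.lt_floor_add_one _)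
    have hkn : ⌊x / h⌋₊ + 1 ≤ n := by
      have : (⌊x / h⌋₊ : ℝ) * h < n * h := by rw [hnh]; exact hkx.trans_lt hx.2
      exact_mod_cast lt_of_mul_lt_mul_right this hpos.le
    refine hs _ (Finset.mem_Icc.2 ⟨by omega, hkn⟩) x ?_
    push_cast
    split_ifs
    · exact ⟨by linarith, hxk.le⟩
    · exact ⟨by linarith, hxk⟩
  have hshift : ∀ x ∈ Set.Ico h 1, s (x - h) = z ⌊x / h⌋₊ := by
    intro x hx
    rw [hstep _ ⟨sub_nonneg.2 hx.1, by linarith [hx.2]⟩]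
    congr 1
    have hone : 1 ≤ ⌊x / h⌋₊ := Nat.one_le_floor_iff _ |>.2 ((one_le_div hpos).2 hx.1)
    rw [sub_div, div_self hpos.ne', Nat.floor_sub_one]
    omega
  have hw'L : MemLp w' 2 (volume.restrict (Set.Ioc 0 1)) :=
    (memLp_two_iff_integrable_sq hw'i.1.aestronglyMeasurable).2 hw'2.1
  have hwL : MemLp w 2 (volume.restrict (Set.Ioc h 1)) := by
    have hcont : ContinuousOn w (Set.Icc 0 1) := by
      have := intervalIntegral.continuousOn_primitive_interval' hw'i
        (Set.left_mem_uIcc)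
      rw [Set.uIcc_of_le zero_le_one] at this
      exact (continuousOn_const.add this).congr hw
    have hL : MemLp w 2 (volume.restrict (Set.Icc 0 1)) := by
      obtain ⟨C, hC⟩ := isCompact_Icc.exists_bound_of_continuousOn hcont
      exact MemLp.of_bound (hcont.aestronglyMeasurable measurableSet_Icc) C
        (ae_restrict_of_forall_mem measurableSet_Icc hC)
    exact hL.mono_measure (Measure.restrict_mono
      (Set.Ioc_subset_Icc_self.trans (Set.Icc_subset_Icc hpos.le le_rfl)) le_rfl)
  obtain ⟨e, he⟩ := exists_sq_step_sub_le hpos hnh hw'L hw z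
  have hmain := integral_pow_four_le hhalf
    ((memLp_comp_floor_div hpos (fun i => z (i + 1)) h 1).sub hwL) he
  simp only [Pi.sub_apply] at hmain
  have hsw : ∀ x ∈ Set.Ico h 1, s x = z (⌊x / h⌋₊ + 1) := fun x hx =>
    hstep x ⟨hpos.le.trans hx.1, hx.2⟩
  rw [intervalIntegral_congr_Ico h1 fun x hx => by rw [hsw x hx],
    intervalIntegral_congr_Ico (f := fun x => (s x - w x) ^ 2) h1 fun x hx => by rw [hsw x hx],
    intervalIntegral_congr_Ico (f := fun x => ((s x - s (x - h)) / h - w' x) ^ 2) h1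
      fun x hx => by rw [hsw x hx, hshift x hx]]
  refine hmain.trans ?_
  have hb : 0 ≤ ∫ x in h..1, (w' x - w' (x - h)) ^ 2 :=
    intervalIntegral.integral_nonneg h1 fun _ _ => sq_nonneg _
  gcongr
  · exact intervalIntegral.integral_nonneg h1 fun _ _ => sq_nonneg _
  · linarith
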